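/- Let X be a variable and e, f expressions. Then ν X = e ≡ ν X = f provided that for every valuation η: (1) for the largest r ∈ R̂ satisfying r = η[X:=r](e) there exists r' ∈ R̂ with r' ≥ r and r' ≤ η[X:=r'](f); and (2) for the largest r ∈ R̂ satisfying r = η[X:=r](f) there exists r' ∈ R̂ with r' ≥ r and r' ≤ η[X:=r'](e). (Such largest r exist, since the map r ↦ η[X:=r](e) is monotone on the complete lattice R̂.) -/

import Mathlib

namespace RESpaper

noncomputable section

/-- Addition on the extended reals in which `⊤` (i.e. `∞`) dominates. -/
def eadd (x y : EReal) : EReal := if x = ⊤ ∨ y = ⊤ then ⊤ else x + y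

/-- The operator `eq-∞`. -/
def eqNegInfVal (x : EReal) : EReal := if x = ⊥ then ⊥ else ⊤

/-- The operator `eq∞`. -/
def eqInfVal (x : EReal) : EReal := if x = ⊤ then ⊤ else ⊥

open Classical in
/-- The sum, with respect to `eadd`, of a finite family of extended reals. -/
def eSum {ι : Type*} (s : Finset ι) (e : ι → EReal) : EReal :=
  if ∃ i ∈ s, e i = ⊤ then ⊤ else ∑ i ∈ s, e i

/-- Syntax of expressions over a set `V` of variables. -/
inductive Expr (V : Type*) where
  | var : V → Expr V
  | const : EReal → Expr V
  | scale : {c : ℝ // 0 < c} → Expr V → Expr V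
  | add : Expr V → Expr V → Expr V
  | emin : Expr V → Expr V → Expr V
  | emax : Expr V → Expr V → Expr V
  | condL : Expr V → Expr V → Expr V → Expr V   -- (e₁ ⇒ e₂ ◇ e₃)
  | condR : Expr V → Expr V → Expr V → Expr V   -- (e₁ → e₂ ◇ e₃)
  | eqm : Expr V → Expr V                       -- eq-∞(e)

variable {V : Type*}

/-- Evaluation of an expression under a valuation `η`. -/
def Expr.eval (η : V → EReal) : Expr V → EReal
  | var X => η X
  | const d => d
  | scale c e => (c.1 : EReal) * Expr.eval η e
  | add e₁ e₂ => eadd (Expr.eval η e₁) (Expr.eval η e₂)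
  | emin e₁ e₂ => Expr.eval η e₁ ⊓ Expr.eval η e₂
  | emax e₁ e₂ => Expr.eval η e₁ ⊔ Expr.eval η e₂
  | condL e₁ e₂ e₃ =>
      if Expr.eval η e₁ ≤ 0 then Expr.eval η e₂ ⊓ Expr.eval η e₃ else Expr.eval η e₃
  | condR e₁ e₂ e₃ =>
      if Expr.eval η e₁ < 0 then Expr.eval η e₂ else Expr.eval η e₂ ⊔ Expr.eval η e₃
  | eqm e => eqNegInfVal (Expr.eval η e)

/-- The set of variables occurring in an expression. -/
def Expr.occ : Expr V → Set V
  | var X => {X}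
  | const _ => ∅
  | scale _ e => Expr.occ e
  | add e₁ e₂ => Expr.occ e₁ ∪ Expr.occ e₂
  | emin e₁ e₂ => Expr.occ e₁ ∪ Expr.occ e₂
  | emax e₁ e₂ => Expr.occ e₁ ∪ Expr.occ e₂
  | condL e₁ e₂ e₃ => Expr.occ e₁ ∪ Expr.occ e₂ ∪ Expr.occ e₃
  | condR e₁ e₂ e₃ => Expr.occ e₁ ∪ Expr.occ e₂ ∪ Expr.occ e₃
  | eqm e => Expr.occ e

/-- `e` contains no occurrence of the conditional operators. -/
def Expr.noCond : Expr V → Prop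
  | var _ => True
  | const _ => True
  | scale _ e => Expr.noCond e
  | add e₁ e₂ => Expr.noCond e₁ ∧ Expr.noCond e₂
  | emin e₁ e₂ => Expr.noCond e₁ ∧ Expr.noCond e₂
  | emax e₁ e₂ => Expr.noCond e₁ ∧ Expr.noCond e₂
  | condL _ _ _ => False
  | condR _ _ _ => False
  | eqm e => Expr.noCond e

/-- Syntactic substitution `e[X := g]`. -/
def Expr.subst [DecidableEq V] (X : V) (g : Expr V) : Expr V → Expr V
  | var Y => if Y = X then g else var Y
  | const d => const d
  | scale c e => scale c (Expr.subst X g e)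
  | add e₁ e₂ => add (Expr.subst X g e₁) (Expr.subst X g e₂)
  | emin e₁ e₂ => emin (Expr.subst X g e₁) (Expr.subst X g e₂)
  | emax e₁ e₂ => emax (Expr.subst X g e₁) (Expr.subst X g e₂)
  | condL e₁ e₂ e₃ => condL (Expr.subst X g e₁) (Expr.subst X g e₂) (Expr.subst X g e₃)
  | condR e₁ e₂ e₃ => condR (Expr.subst X g e₁) (Expr.subst X g e₂) (Expr.subst X g e₃)
  | eqm e => eqm (Expr.subst X g e)

/-- `(Σ_{(c,X) ∈ cs} c·X) + rest`. -/
def scaledSum (cs : List ({c : ℝ // 0 < c} × V)) (rest : Expr V) : Expr V :=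
  cs.foldr (fun p acc => Expr.add (Expr.scale p.1 (Expr.var p.2)) acc) rest

/-- `(Σ_{X ∈ ms} eq-∞(X)) + rest`. -/
def eqmSum (ms : List V) (rest : Expr V) : Expr V :=
  ms.foldr (fun X acc => Expr.add (Expr.eqm (Expr.var X)) acc) rest

/-- A term of the shape `(Σ_{X∈𝒳'} c^X·X) + (Σ_{X∈𝒳''} eq-∞(X)) + d`
with the variables in each of the two sums pairwise distinct. -/
def IsSimpleTerm (e : Expr V) : Prop :=
  ∃ (cs : List ({c : ℝ // 0 < c} × V)) (ms : List V) (d : EReal),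
    (cs.map Prod.snd).Nodup ∧ ms.Nodup ∧ e = scaledSum cs (eqmSum ms (Expr.const d))

/-- Finite disjunction; the empty disjunction is `−∞`. -/
def disjList : List (Expr V) → Expr V
  | [] => Expr.const ⊥
  | [e] => e
  | e :: es => Expr.emax e (disjList es)

/-- Finite conjunction; the empty conjunction is `∞`. -/
def conjList : List (Expr V) → Expr V
  | [] => Expr.const ⊤
  | [e] => e
  | e :: es => Expr.emin e (conjList es)

/-- Simple conjunctive normal form. -/
def IsSimpleCNF (e : Expr V) : Prop :=
  ∃ ls : List (List (Expr V)),
    (∀ l ∈ ls, ∀ t ∈ l, IsSimpleTerm t) ∧ e = conjList (ls.map disjList)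

/-- Simple disjunctive normal form. -/
def IsSimpleDNF (e : Expr V) : Prop :=
  ∃ ls : List (List (Expr V)),
    (∀ l ∈ ls, ∀ t ∈ l, IsSimpleTerm t) ∧ e = disjList (ls.map conjList)

/-- Conjunctive normal form. -/
inductive IsCNF : Expr V → Prop where
  | simple {e : Expr V} : IsSimpleCNF e → IsCNF e
  | condL {e₁ e₂ e₃ : Expr V} :
      IsSimpleCNF e₁ → IsCNF e₂ → IsCNF e₃ → IsCNF (Expr.condL e₁ e₂ e₃)
  | condR {e₁ e₂ e₃ : Expr V} :
      IsSimpleCNF e₁ → IsCNF e₂ → IsCNF e₃ → IsCNF (Expr.condR e₁ e₂ e₃)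

/-- Disjunctive normal form. -/
inductive IsDNF : Expr V → Prop where
  | simple {e : Expr V} : IsSimpleDNF e → IsDNF e
  | condL {e₁ e₂ e₃ : Expr V} :
      IsSimpleDNF e₁ → IsDNF e₂ → IsDNF e₃ → IsDNF (Expr.condL e₁ e₂ e₃)
  | condR {e₁ e₂ e₃ : Expr V} :
      IsSimpleDNF e₁ → IsDNF e₂ → IsDNF e₃ → IsDNF (Expr.condR e₁ e₂ e₃)

/-- Fixed-point symbols. -/
inductive FP where
  | mu : FP
  | nu : FP

/-- A real equation system: a finite sequence of fixed-point equations `σ X = e`. -/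
abbrev RES (V : Type*) := List (FP × V × Expr V)

/-- The bound variables of a RES. -/
def bnd (E : RES V) : List V := E.map (fun p => p.2.1)

variable [DecidableEq V]

/-- The solution `[[ℰ]]η` of a real equation system. -/
def sol : RES V → (V → EReal) → V → EReal
  | [], η => η
  | (FP.mu, X, e) :: E, η =>
      sol E (Function.update η X
        (sInf {r : EReal | Expr.eval (sol E (Function.update η X r)) e ≤ r}))
  | (FP.nu, X, e) :: E, η =>
      sol E (Function.update η X
        (sSup {r : EReal | r ≤ Expr.eval (sol E (Function.update η X r)) e}))

/-- Equivalence of real equation systems. -/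
def REquiv (E E' : RES V) : Prop :=
  ∀ F : RES V, (∀ Y ∈ bnd F, Y ∉ bnd E ∧ Y ∉ bnd E') →
    ∀ η : V → EReal, sol (E ++ F) η = sol (E' ++ F) η


theorem eadd_mono {a b c d : EReal} (hac : a ≤ c) (hbd : b ≤ d) : eadd a b ≤ eadd c d := by
  unfold eadd
  by_cases h : c = ⊤ ∨ d = ⊤
  · simp [h]
  · have h' : ¬ (a = ⊤ ∨ b = ⊤) := by
      rintro (rfl | rfl)
      · exact h (Or.inl (top_le_iff.mp hac))
      · exact h (Or.inr (top_le_iff.mp hbd))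
    rw [if_neg h, if_neg h']
    exact add_le_add hac hbd

theorem eqNegInfVal_mono : Monotone eqNegInfVal := by
  intro a b hab
  unfold eqNegInfVal
  by_cases ha : a = ⊥
  · simp [ha]
  · have hb : b ≠ ⊥ := fun hb => ha (le_bot_iff.mp (hb ▸ hab))
    simp [hb]

theorem Expr.eval_mono {W : Type*} (e : Expr W) :
    Monotone fun η : W → EReal => Expr.eval η e := by
  intro η θ h
  induction e with
  | var X => exact h X
  | const d => exact le_rfl
  | scale c e ih =>
    exact mul_le_mul_of_nonneg_left ih (EReal.coe_nonneg.mpr c.2.le)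
  | add e₁ e₂ ih₁ ih₂ => exact eadd_mono ih₁ ih₂
  | emin e₁ e₂ ih₁ ih₂ => exact inf_le_inf ih₁ ih₂
  | emax e₁ e₂ ih₁ ih₂ => exact sup_le_sup ih₁ ih₂
  | condL e₁ e₂ e₃ ih₁ ih₂ ih₃ =>
    simp only [Expr.eval] at ih₁ ih₂ ih₃ ⊢
    split_ifs with h₁ h₂
    · exact inf_le_inf ih₂ ih₃
    · exact inf_le_right.trans ih₃
    · exact absurd (ih₁.trans ‹_›) h₁
    · exact ih₃
  | condR e₁ e₂ e₃ ih₁ ih₂ ih₃ =>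
    simp only [Expr.eval] at ih₁ ih₂ ih₃ ⊢
    split_ifs with h₁ h₂
    · exact ih₂
    · exact ih₂.trans le_sup_left
    · exact absurd (ih₁.trans_lt ‹_›) h₁
    · exact sup_le_sup ih₂ ih₃
  | eqm e ih => exact eqNegInfVal_mono ih

theorem sol_mono (E : RES V) : Monotone (sol E) := by
  induction E with
  | nil => exact fun η θ h => h
  | cons p E ih =>
    obtain ⟨σ, X, e⟩ := p
    intro η θ h
    have key (r : EReal) : Expr.eval (sol E (Function.update η X r)) e ≤
        Expr.eval (sol E (Function.update θ X r)) e :=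
      e.eval_mono (ih (update_le_update_iff.mpr ⟨le_rfl, fun Y _ => h Y⟩))
    cases σ with
    | mu =>
      exact ih (update_le_update_iff.mpr
        ⟨sInf_le_sInf fun r hr => (key r).trans hr, fun Y _ => h Y⟩)
    | nu =>
      exact ih (update_le_update_iff.mpr
        ⟨sSup_le_sSup fun r hr => le_trans hr (key r), fun Y _ => h Y⟩)

/-- A variable that is not bound by `E` keeps its value. -/
theorem sol_apply_of_notMem_bnd {E : RES V} {X : V} (hX : X ∉ bnd E) (η : V → EReal) :
    sol E η X = η X := by
  induction E generalizing η with
  | nil => rfl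
  | cons p E ih =>
    obtain ⟨σ, Y, e⟩ := p
    simp only [bnd, List.map_cons, List.mem_cons, not_or] at hX
    cases σ <;>
    · simp only [sol]
      rw [ih hX.2, Function.update_of_ne hX.1]

theorem isGreatest_gfp_setOf_eq {α : Type*} [CompleteLattice α] (g : α →o α) :
    IsGreatest {s | g s = s} g.gfp :=
  ⟨g.map_gfp, fun _ hs => g.le_gfp hs.ge⟩

theorem sSup_postfixed_le (X : V) (e f : Expr V)
    (h : ∀ (η : V → EReal) (r : EReal),
      IsGreatest {s : EReal | Expr.eval (Function.update η X s) e = s} r →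
      ∃ r' : EReal, r ≤ r' ∧ r' ≤ Expr.eval (Function.update η X r') f)
    {F : RES V} (hX : X ∉ bnd F) (η : V → EReal) :
    sSup {r : EReal | r ≤ Expr.eval (sol F (Function.update η X r)) e} ≤
      sSup {r : EReal | r ≤ Expr.eval (sol F (Function.update η X r)) f} := by
  have update_mono (θ : V → EReal) : Monotone (Function.update θ X) :=
    fun _ _ hrs => update_le_update_iff.mpr ⟨hrs, fun _ _ => le_rfl⟩
  refine sSup_le fun r hr => ?_
  set θ := sol F (Function.update η X r) with hθ
  let g : EReal →o EReal :=
    ⟨fun s => Expr.eval (Function.update θ X s) e, e.eval_mono.comp (update_mono θ)⟩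
  have hθX : θ X = r := by simp [hθ, sol_apply_of_notMem_bnd hX]
  have hrg : r ≤ g.gfp := by
    refine g.le_gfp ?_
    change r ≤ Expr.eval (Function.update θ X r) e
    rw [← hθX, Function.update_eq_self, hθX]
    exact hr
  obtain ⟨r', hgr', hr'⟩ := h θ g.gfp (isGreatest_gfp_setOf_eq g)
  have hrr' : r ≤ r' := hrg.trans hgr'
  refine hrr'.trans (le_sSup (hr'.trans (f.eval_mono ?_)))
  refine update_le_iff.mpr ⟨?_, fun Y _ => sol_mono F (update_mono η hrr') Y⟩
  simp [sol_apply_of_notMem_bnd hX]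

/-- sufficient condition for `ν X = e ≡ ν X = f`. -/
theorem generic1_nu (X : V) (e f : Expr V)
    (h1 : ∀ (η : V → EReal) (r : EReal),
      IsGreatest {s : EReal | Expr.eval (Function.update η X s) e = s} r →
      ∃ r' : EReal, r ≤ r' ∧ r' ≤ Expr.eval (Function.update η X r') f)
    (h2 : ∀ (η : V → EReal) (r : EReal),
      IsGreatest {s : EReal | Expr.eval (Function.update η X s) f = s} r →
      ∃ r' : EReal, r ≤ r' ∧ r' ≤ Expr.eval (Function.update η X r') e) :
    REquiv [(FP.nu, X, e)] [(FP.nu, X, f)] := by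
  intro F hF η
  have hX : X ∉ bnd F := fun h => (hF X h).1 (by simp [bnd])
  simp only [List.cons_append, List.nil_append, sol]
  rw [le_antisymm (sSup_postfixed_le X e f h1 hX η) (sSup_postfixed_le X f e h2 hX η)]

end
end RESpaper
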